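/- arXiv:math/0610644 — 2 statements merged into one kernel-verified Lean document; each statement's English description precedes it below -/
import Mathlib

section
/- Let V be a symplectic vector space over a field F (char ≠ 2), ℓ₁, ℓ₂ ⊂ V Lagrangian subspaces, and T := {(x,y) ∈ V × V | x - y ∈ ℓ₁ + ℓ₂}. For (x,y) ∈ T, choose a₁ ∈ ℓ₁, a₂ ∈ ℓ₂ with x - y = a₁ + a₂, and define Q((x,y)) := ⟨a₁, x⟩ + ⟨a₂, y⟩. Then Q((x,y)) is independent of the choice of a₁, a₂. -/
/-- A Lagrangian subspace: isotropic and coisotropic. -/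
def IsLagrangian {F M : Type*} [Field F] [AddCommGroup M] [Module F M]
    (B : M → M → F) (ℓ : Submodule F M) : Prop :=
  (∀ x ∈ ℓ, ∀ y ∈ ℓ, B x y = 0) ∧ ∀ x : M, (∀ y ∈ ℓ, B x y = 0) → x ∈ ℓ

/-- For Lagrangians `ℓ₁, ℓ₂` and `(x,y)` with `x - y ∈ ℓ₁ + ℓ₂`, the value
`Q((x,y)) = ω a₁ x + ω a₂ y` (where `x - y = a₁ + a₂`, `aᵢ ∈ ℓᵢ`) is independent of the
choice of `a₁, a₂`. -/
theorem stmt4 {F V : Type*} [Field F] [AddCommGroup V] [Module F V]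
    [FiniteDimensional F V] (hchar : (2 : F) ≠ 0)
    (ω : V →ₗ[F] V →ₗ[F] F) (halt : ∀ v, ω v v = 0)
    (hnd : ∀ v, (∀ w, ω v w = 0) → v = 0)
    (ℓ₁ ℓ₂ : Submodule F V)
    (h₁ : IsLagrangian (fun x y => ω x y) ℓ₁)
    (h₂ : IsLagrangian (fun x y => ω x y) ℓ₂) :
    ∀ x y a₁ a₂ b₁ b₂ : V, a₁ ∈ ℓ₁ → a₂ ∈ ℓ₂ → b₁ ∈ ℓ₁ → b₂ ∈ ℓ₂ →
      x - y = a₁ + a₂ → x - y = b₁ + b₂ →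
      ω a₁ x + ω a₂ y = ω b₁ x + ω b₂ y := by
  intro x y a₁ a₂ b₁ b₂ ha₁ ha₂ hb₁ hb₂ ha hb
  have hε : a₁ - b₁ = b₂ - a₂ := by
    rw [sub_eq_sub_iff_add_eq_add, ← ha, hb, add_comm]
  have hε₁ : ω (a₁ - b₁) a₁ = 0 := h₁.1 _ (sub_mem ha₁ hb₁) _ ha₁
  have hε₂ : ω (a₁ - b₁) a₂ = 0 := hε ▸ h₂.1 _ (sub_mem hb₂ ha₂) _ ha₂
  have hxy : ω (a₁ - b₁) x = ω (b₂ - a₂) y := by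
    rw [← hε, ← sub_eq_zero, ← map_sub, ha, map_add, hε₁, hε₂, add_zero]
  simp only [map_sub, LinearMap.sub_apply] at hxy
  linear_combination hxy
end

section
/- Let V be a symplectic vector space over a field F (char ≠ 2), g ∈ Sp(V), and ℓ a Lagrangian subspace. Let S be the middle cohomology of the complex ker(g-1) → V/ℓ →^{g-1} V/(gℓ+ℓ). Then dim S = (1/2)dim V - dim ker(g-1) - dim(gℓ ∩ ℓ) + 2·dim(ℓ ∩ ker(g-1)). -/
open Module

/-- Rank-nullity for the restriction of a linear map to a subspace. -/
theorem finrank_map_add_finrank_inf_ker {F V W : Type*} [Field F] [AddCommGroup V] [Module F V]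
    [FiniteDimensional F V] [AddCommGroup W] [Module F W] (f : V →ₗ[F] W) (N : Submodule F V) :
    finrank F (N.map f) + finrank F ↥(N ⊓ LinearMap.ker f) = finrank F N := by
  rw [← LinearMap.finrank_range_add_finrank_ker (f.domRestrict N), LinearMap.range_domRestrict,
    LinearMap.ker_domRestrict, ← Submodule.finrank_map_subtype_eq N,
    Submodule.map_comap_subtype]

theorem IsLagrangian.orthogonal_eq {F V : Type*} [Field F] [AddCommGroup V] [Module F V]
    {ω : LinearMap.BilinForm F V} (hω : ω.IsRefl) {ℓ : Submodule F V}
    (hℓ : IsLagrangian (fun x y => ω x y) ℓ) : ω.orthogonal ℓ = ℓ := by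
  ext x
  exact ⟨fun hx => hℓ.2 x fun y hy => hω y x (hx y hy), fun hx y hy => hℓ.1 y hy x hx⟩

/-- An isometry maps Lagrangian subspaces to Lagrangian subspaces. -/
theorem IsLagrangian.map {F V : Type*} [Field F] [AddCommGroup V] [Module F V]
    {ω : LinearMap.BilinForm F V} {ℓ : Submodule F V} (hℓ : IsLagrangian (fun x y => ω x y) ℓ)
    (g : V ≃ₗ[F] V) (hg : ∀ v w, ω (g v) (g w) = ω v w) :
    IsLagrangian (fun x y => ω x y) (ℓ.map (g : V →ₗ[F] V)) := by
  refine ⟨?_, fun x hx => ⟨g.symm x, hℓ.2 _ fun y hy => ?_, g.apply_symm_apply x⟩⟩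
  · rintro _ ⟨x, hx, rfl⟩ _ ⟨y, hy, rfl⟩
    exact (hg x y).trans (hℓ.1 x hx y hy)
  · simpa [← hg (g.symm x) y] using hx (g y) ⟨y, hy, rfl⟩

/-- The sum of two Lagrangian subspaces is the orthogonal of their intersection. -/
theorem IsLagrangian.orthogonal_inf {F V : Type*} [Field F] [AddCommGroup V] [Module F V]
    [FiniteDimensional F V] {ω : LinearMap.BilinForm F V} (hω : ω.IsRefl) (hnd : ω.Nondegenerate)
    {ℓ m : Submodule F V} (hℓ : IsLagrangian (fun x y => ω x y) ℓ)
    (hm : IsLagrangian (fun x y => ω x y) m) : ω.orthogonal (ℓ ⊓ m) = ℓ ⊔ m := by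
  have h : ω.orthogonal (ℓ ⊔ m) = ℓ ⊓ m := by
    refine le_antisymm (le_inf ?_ ?_) fun x hx y hy => ?_
    · exact (LinearMap.BilinForm.orthogonal_le le_sup_left).trans (hℓ.orthogonal_eq hω).le
    · exact (LinearMap.BilinForm.orthogonal_le le_sup_right).trans (hm.orthogonal_eq hω).le
    · obtain ⟨a, ha, b, hb, rfl⟩ := Submodule.mem_sup.mp hy
      simp [show ω a x = 0 from hℓ.1 a ha x hx.1, show ω b x = 0 from hm.1 b hb x hx.2]
  rw [← h, LinearMap.BilinForm.orthogonal_orthogonal hnd hω]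

/-- With `dim V = 2n`, `ℓ` Lagrangian, `g ∈ Sp(V)`, `f = g - 1`, and `S`
the middle cohomology of `ker f → V/ℓ → V/(gℓ + ℓ)`, we have
`dim S = n - dim ker f - dim(gℓ ∩ ℓ) + 2 dim(ℓ ∩ ker f)`.  Here
`dim S = dim f⁻¹(gℓ + ℓ) - dim(ker f ⊔ ℓ)`, and the formula is stated additively. -/
theorem stmt12 {F V : Type*} [Field F] [AddCommGroup V] [Module F V]
    [FiniteDimensional F V] (hchar : (2 : F) ≠ 0)
    (ω : V →ₗ[F] V →ₗ[F] F) (halt : ∀ v, ω v v = 0)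
    (hnd : ∀ v, (∀ w, ω v w = 0) → v = 0)
    (g : V ≃ₗ[F] V) (hg : ∀ v w, ω (g v) (g w) = ω v w)
    (f : V →ₗ[F] V) (hf : ∀ v, f v = g v - v)
    (ℓ : Submodule F V) (hℓ : IsLagrangian (fun x y => ω x y) ℓ)
    (n : ℕ) (hn : Module.finrank F V = 2 * n) :
    Module.finrank F ↥(Submodule.comap f (ℓ.map (g : V →ₗ[F] V) ⊔ ℓ))
      + Module.finrank F ↥(LinearMap.ker f)
      + Module.finrank F ↥(ℓ.map (g : V →ₗ[F] V) ⊓ ℓ)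
    = Module.finrank F ↥(LinearMap.ker f ⊔ ℓ) + n
      + 2 * Module.finrank F ↥(ℓ ⊓ LinearMap.ker f) := by
  have hω : LinearMap.BilinForm.IsRefl ω := LinearMap.IsAlt.isRefl halt
  have hnd' : LinearMap.Nondegenerate ω := hω.nondegenerate_iff_separatingLeft.mpr hnd
  let f' : V →ₗ[F] V := (g.symm : V →ₗ[F] V) - LinearMap.id
  have hadj (x y : V) : ω y (f x) = ω (f' y) x := by
    simp [f', hf, ← hg (g.symm y) x]
  have hcomap : Submodule.comap f (ℓ.map (g : V →ₗ[F] V) ⊔ ℓ)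
      = LinearMap.BilinForm.orthogonal ω ((ℓ.map (g : V →ₗ[F] V) ⊓ ℓ).map f') := by
    rw [← (hℓ.map g hg).orthogonal_inf hω hnd' hℓ]
    ext x
    simp only [Submodule.mem_comap, LinearMap.BilinForm.mem_orthogonal_iff, hadj,
      Submodule.mem_map, forall_exists_index, and_imp, forall_apply_eq_imp_iff₂]
  have hker : (ℓ.map (g : V →ₗ[F] V) ⊓ ℓ) ⊓ LinearMap.ker f' = ℓ ⊓ LinearMap.ker f := by
    have hfix (x : V) : f' x = 0 ↔ f x = 0 := by
      simpa [f', hf, sub_eq_zero, LinearEquiv.symm_apply_eq] using eq_comm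
    ext x
    simp only [Submodule.mem_inf, LinearMap.mem_ker, hfix]
    refine ⟨fun h => ⟨h.1.2, h.2⟩, fun h => ⟨⟨⟨x, h.1, ?_⟩, h.1⟩, h.2⟩⟩
    simpa [hf, sub_eq_zero] using h.2
  have hmap := finrank_map_add_finrank_inf_ker f' (ℓ.map (g : V →ₗ[F] V) ⊓ ℓ)
  have hdim := LinearMap.BilinForm.finrank_orthogonal hnd' ℓ
  have hS := LinearMap.BilinForm.finrank_orthogonal hnd' ((ℓ.map (g : V →ₗ[F] V) ⊓ ℓ).map f')
  have hle := Submodule.finrank_le ((ℓ.map (g : V →ₗ[F] V) ⊓ ℓ).map f')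
  have hsup := Submodule.finrank_sup_add_finrank_inf_eq (LinearMap.ker f) ℓ
  rw [hker] at hmap
  rw [hℓ.orthogonal_eq hω] at hdim
  rw [← hcomap] at hS
  rw [inf_comm] at hsup
  lia
end
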